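/- In the four-player NE-free example (game form of size 6 × 8 × 4 × 2 over outcomes {a₁,...,a₅, c} as specified by the positional game on the given digraph), for every strategy profile s there exists a player i and a unilateral deviation s′ of player i such that the outcome g(s′) is strictly preferred to g(s) by player i, for every preference profile extending the partial orders O₁: a₂>a₄>a₃>a₁>a₅; O₂: min(a₁,c)>a₃>max(a₄,a₅)>min(a₄,a₅)>a₂; O₃: min(a₅,c)>a₁>a₂>max(a₃,a₄); O₄: min(a₁,a₂,a₃,a₅)>a₄>c. -/

import Mathlib

/-! STATEMENT 14: the specific four-player positional game of the paper has no
Nash equilibrium in pure stationary strategies for any preference profile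
extending the stated partial orders. -/

/-- Positions of the game: eight non-terminal positions and five terminals. -/
inductive GV | u1 | v1 | u2 | v2 | w2 | u3 | v3 | u4 | a1 | a2 | a3 | a4 | a5
  deriving DecidableEq

open GV

/-- The outgoing edges of the digraph. -/
def succs : GV → List GV
  | u1 => [u2, u3]
  | v1 => [v2, u4, w2]
  | u2 => [v1, v3]
  | v2 => [u4, a3]
  | w2 => [u3, a5]
  | u3 => [v3, a1]
  | v3 => [v2, a2]
  | u4 => [w2, a4]
  | _ => []

/-- The player controlling each non-terminal position (terminals: `none`). -/
def gowner : GV → Option (Fin 4)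
  | u1 => some 0 | v1 => some 0
  | u2 => some 1 | v2 => some 1 | w2 => some 1
  | u3 => some 2 | v3 => some 2
  | u4 => some 3
  | _ => none

/-- Outcomes: the five terminals and the cycle outcome `c`. -/
inductive GO | t1 | t2 | t3 | t4 | t5 | c
  deriving DecidableEq

/-- One step of the play under the stationary profile `σ` (terminals are fixed). -/
def gstep (σ : GV → GV) (v : GV) : GV := if succs v = [] then v else σ v

/-- The outcome of the play starting from the initial position `u1` under `σ`:
since there are only eight non-terminal positions, after 13 steps the play has
either reached a terminal or it cycles forever (outcome `c`). -/
def gout (σ : GV → GV) : GO :=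
  match (gstep σ)^[13] u1 with
  | a1 => GO.t1 | a2 => GO.t2 | a3 => GO.t3 | a4 => GO.t4 | a5 => GO.t5
  | _ => GO.c

/-- A profile is valid if at every non-terminal position it chooses an outgoing edge. -/
def ValidP (σ : GV → GV) : Prop := ∀ v, succs v ≠ [] → σ v ∈ succs v

/-- The stationary profile with prescribed moves at the non-terminal positions. -/
def profile (x₁ y₁ x₂ y₂ z₂ x₃ y₃ x₄ : GV) : GV → GV
  | u1 => x₁ | v1 => y₁
  | u2 => x₂ | v2 => y₂ | w2 => z₂
  | u3 => x₃ | v3 => y₃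
  | u4 => x₄
  | v => v

/-- The level of an outcome in the partial order of a player (higher is better); level `0` marks
an outcome that the order does not compare with any other. -/
def level : Fin 4 → GO → ℕ := ![
  fun | .t2 => 5 | .t4 => 4 | .t3 => 3 | .t1 => 2 | .t5 => 1 | .c => 0,
  fun | .t1 | .c => 4 | .t3 => 3 | .t4 | .t5 => 2 | .t2 => 1,
  fun | .t5 | .c => 4 | .t1 => 3 | .t2 => 2 | .t3 | .t4 => 1,
  fun | .t4 => 2 | .c => 1 | _ => 3]

/-- Outcome `x` is above outcome `y` in the partial order of player `i`. -/
abbrev Better (i : Fin 4) (x y : GO) : Prop := 0 < level i y ∧ level i y < level i x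

/-- The outcome depends only on the moves at the non-terminal positions. -/
theorem gout_congr {σ τ : GV → GV} (h : ∀ v, succs v ≠ [] → σ v = τ v) : gout σ = gout τ := by
  have : gstep σ = gstep τ := by
    funext v
    unfold gstep
    split_ifs with hv
    exacts [rfl, h v hv]
  unfold gout
  generalize gstep σ = f at this ⊢
  subst this
  rfl

/-- At every choice of moves, some player can change their own moves to reach a better outcome. -/
theorem exists_better_profile :
    ∀ x₁ ∈ succs u1, ∀ y₁ ∈ succs v1, ∀ x₂ ∈ succs u2, ∀ y₂ ∈ succs v2, ∀ z₂ ∈ succs w2,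
    ∀ x₃ ∈ succs u3, ∀ y₃ ∈ succs v3, ∀ x₄ ∈ succs u4,
      (∃ x ∈ succs u1, ∃ y ∈ succs v1,
        Better 0 (gout (profile x y x₂ y₂ z₂ x₃ y₃ x₄))
          (gout (profile x₁ y₁ x₂ y₂ z₂ x₃ y₃ x₄))) ∨
      (∃ x ∈ succs u2, ∃ y ∈ succs v2, ∃ z ∈ succs w2,
        Better 1 (gout (profile x₁ y₁ x y z x₃ y₃ x₄))
          (gout (profile x₁ y₁ x₂ y₂ z₂ x₃ y₃ x₄))) ∨
      (∃ x ∈ succs u3, ∃ y ∈ succs v3,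
        Better 2 (gout (profile x₁ y₁ x₂ y₂ z₂ x y x₄))
          (gout (profile x₁ y₁ x₂ y₂ z₂ x₃ y₃ x₄))) ∨
      (∃ x ∈ succs u4,
        Better 3 (gout (profile x₁ y₁ x₂ y₂ z₂ x₃ y₃ x))
          (gout (profile x₁ y₁ x₂ y₂ z₂ x₃ y₃ x₄))) := by
  decide +kernel

/-- Every valid profile admits a valid unilateral deviation to a better outcome. -/
theorem exists_better_deviation (σ : GV → GV) (hσ : ValidP σ) :
    ∃ (i : Fin 4) (τ : GV → GV), ValidP τ ∧ (∀ v, gowner v ≠ some i → τ v = σ v) ∧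
      Better i (gout τ) (gout σ) := by
  have key (i : Fin 4) (p q : GV → GV) (hp : ValidP p)
      (hpq : ∀ v, succs v ≠ [] → gowner v ≠ some i → p v = σ v)
      (hq : ∀ v, succs v ≠ [] → σ v = q v) (hb : Better i (gout p) (gout q)) :
      ∃ (i : Fin 4) (τ : GV → GV), ValidP τ ∧ (∀ v, gowner v ≠ some i → τ v = σ v) ∧
        Better i (gout τ) (gout σ) := by
    refine ⟨i, fun v => if succs v = [] then σ v else p v, fun v hv => ?_, fun v hv => ?_, ?_⟩
    · simpa [hv] using hp v hv
    · dsimp only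
      split_ifs with h
      exacts [rfl, hpq v h hv]
    · rwa [gout_congr hq, gout_congr (τ := p) fun v hv => by simp [hv]]
  have hm (v : GV) (hv : succs v ≠ [] := by decide) : σ v ∈ succs v := hσ v hv
  rcases exists_better_profile _ (hm u1) _ (hm v1) _ (hm u2) _ (hm v2) _ (hm w2) _ (hm u3)
      _ (hm v3) _ (hm u4) with
    ⟨x, hx, y, hy, hb⟩ | ⟨x, hx, y, hy, z, hz, hb⟩ | ⟨x, hx, y, hy, hb⟩ | ⟨x, hx, hb⟩
  all_goals
    refine key _ _ _ ?_ ?_ ?_ hb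
    · rintro (_ | _) hv
      all_goals first | exact absurd rfl hv | assumption | exact hσ _ hv
    · rintro (_ | _) hv ho
      all_goals first | rfl | exact absurd rfl hv | exact absurd rfl ho
    · rintro (_ | _) hv
      all_goals first | rfl | exact absurd rfl hv

/-- for every pure stationary strategy profile of the main example
there is a player `i` and a unilateral deviation `τ` of player `i` whose outcome
player `i` strictly prefers, for every preference profile extending the stated
partial orders. -/
theorem main_example_always_improvable
    (pref : Fin 4 → GO → GO → Prop)
    (hord : ∀ i, IsStrictTotalOrder GO (pref i))
    -- O₁ : a₂ > a₄ > a₃ > a₁ > a₅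
    (h1a : pref 0 GO.t2 GO.t4) (h1b : pref 0 GO.t4 GO.t3)
    (h1c : pref 0 GO.t3 GO.t1) (h1d : pref 0 GO.t1 GO.t5)
    -- O₂ : min(a₁,c) > a₃ > max(a₄,a₅) > min(a₄,a₅) > a₂
    (h2a : pref 1 GO.t1 GO.t3) (h2b : pref 1 GO.c GO.t3)
    (h2c : pref 1 GO.t3 GO.t4) (h2d : pref 1 GO.t3 GO.t5)
    (h2e : pref 1 GO.t4 GO.t2) (h2f : pref 1 GO.t5 GO.t2)
    -- O₃ : min(a₅,c) > a₁ > a₂ > max(a₃,a₄)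
    (h3a : pref 2 GO.t5 GO.t1) (h3b : pref 2 GO.c GO.t1)
    (h3c : pref 2 GO.t1 GO.t2) (h3d : pref 2 GO.t2 GO.t3) (h3e : pref 2 GO.t2 GO.t4)
    -- O₄ : min(a₁,a₂,a₃,a₅) > a₄ > c
    (h4a : pref 3 GO.t1 GO.t4) (h4b : pref 3 GO.t2 GO.t4)
    (h4c : pref 3 GO.t3 GO.t4) (h4d : pref 3 GO.t5 GO.t4) (h4e : pref 3 GO.t4 GO.c) :
    ∀ σ : GV → GV, ValidP σ →
      ∃ (i : Fin 4) (τ : GV → GV), ValidP τ ∧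
        (∀ v, gowner v ≠ some i → τ v = σ v) ∧
        pref i (gout τ) (gout σ) := by
  intro σ hσ
  obtain ⟨i, τ, hτ, hd, hb⟩ := exists_better_deviation σ hσ
  refine ⟨i, τ, hτ, hd, ?_⟩
  have htrans {x y z : GO} : pref i x y → pref i y z → pref i x z :=
    (hord i).toIsStrictOrder.toIsTrans.trans x y z
  generalize gout τ = x at hb ⊢
  generalize gout σ = y at hb ⊢
  fin_cases i <;> cases x <;> cases y <;> simp [Better, level] at hb <;> grind
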